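/- arXiv:2009.00311 — 5 statements merged into one kernel-verified Lean document; each statement's English description precedes it below -/
import Mathlib

section
/- Let (X,κ) be a κ-connected, κ-contractible finite digital image having more than one point. Then X is reducible, i.e. X is digitally homotopy equivalent to a digital image with strictly fewer points. -/
/-! Basic digital topology definitions (digital images, adjacencies, continuity,
homotopy, contractibility, reducibility, simple closed curves, loops,
digital (higher) topological complexity). -/

/-- 2-adjacency on `ℤ`. -/
def adjZ (a b : ℤ) : Prop := |a - b| = 1

/-- 4-adjacency (`c₁`) on `ℤ²`. -/
def adj4 (p q : ℤ × ℤ) : Prop :=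
  (|p.1 - q.1| = 1 ∧ p.2 = q.2) ∨ (p.1 = q.1 ∧ |p.2 - q.2| = 1)

/-- 8-adjacency (`c₂`) on `ℤ²`. -/
def adj8 (p q : ℤ × ℤ) : Prop :=
  p ≠ q ∧ |p.1 - q.1| ≤ 1 ∧ |p.2 - q.2| ≤ 1

/-- The adjacency relation on `ℤ²` named by `κ ∈ {4, 8}`. -/
def adjK (κ : ℕ) : ℤ × ℤ → ℤ × ℤ → Prop := if κ = 4 then adj4 else adj8

/-- The `c_k`-adjacency on `ℤⁿ`: distinct points, coordinates differing by `1` in at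
most `k` indices, all other coordinates equal. -/
def cAdj (n k : ℕ) (x y : Fin n → ℤ) : Prop :=
  x ≠ y ∧ ((Finset.univ.filter fun i => x i ≠ y i).card ≤ k) ∧
    ∀ i, x i ≠ y i → |x i - y i| = 1

/-- A digital path of length `len`, given by a function on `ℤ` (only its values on
`[0, len]` matter). -/
structure DigPath (α : Type) where
  len : ℕ
  toFun : ℤ → α

/-- An element `(f, p₁, …, pₙ)` of (the ambient type of) `Sₙ(X)`. -/
structure SnElt (α : Type) (n : ℕ) where
  path : DigPath α
  pts : Fin n → α

section

variable {α β : Type} (A : α → α → Prop) (B : β → β → Prop)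

/-- `f` maps the digital image `X` into the digital image `Y`. -/
def DigMapsTo (X : Set α) (Y : Set β) (f : α → β) : Prop := ∀ x ∈ X, f x ∈ Y

/-- Digital `(A,B)`-continuity of `f` on `X`: adjacent points go to equal or
adjacent points. -/
def DigContinuousOn (X : Set α) (f : α → β) : Prop :=
  ∀ x ∈ X, ∀ x' ∈ X, A x x' → f x = f x' ∨ B (f x) (f x')

/-- Digital homotopy between `f` and `g` as maps from `(X, A)` to `(Y, B)`. -/
def DigHomotopic (X : Set α) (Y : Set β) (f g : α → β) : Prop :=
  ∃ (m : ℕ) (F : α → ℤ → β),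
    (∀ x ∈ X, ∀ t ∈ Set.Icc (0 : ℤ) (m : ℤ), F x t ∈ Y) ∧
    (∀ x ∈ X, F x 0 = f x) ∧
    (∀ x ∈ X, F x (m : ℤ) = g x) ∧
    (∀ t ∈ Set.Icc (0 : ℤ) (m : ℤ), DigContinuousOn A B X fun x => F x t) ∧
    (∀ x ∈ X, ∀ t ∈ Set.Icc (0 : ℤ) (m : ℤ), ∀ t' ∈ Set.Icc (0 : ℤ) (m : ℤ),
      adjZ t t' → F x t = F x t' ∨ B (F x t) (F x t'))

/-- The given map `f : (X, A) → (Y, B)` is a digital homotopy equivalence. -/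
def IsDigHomotopyEquiv (X : Set α) (Y : Set β) (f : α → β) : Prop :=
  DigMapsTo X Y f ∧ DigContinuousOn A B X f ∧
    ∃ g : β → α, DigMapsTo Y X g ∧ DigContinuousOn B A Y g ∧
      DigHomotopic A A X X (g ∘ f) id ∧ DigHomotopic B B Y Y (f ∘ g) id

/-- `(X, A)` and `(Y, B)` are digitally homotopy equivalent. -/
def DigHomotopyEquiv (X : Set α) (Y : Set β) : Prop :=
  ∃ f : α → β, IsDigHomotopyEquiv A B X Y f

/-- `(X, A)` is digitally contractible. -/
def DigContractible (X : Set α) : Prop :=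
  ∃ x₀ ∈ X, DigHomotopic A A X X id fun _ => x₀

/-- `(X, A)` is digitally connected. -/
def DigConnected (X : Set α) : Prop :=
  ∀ x ∈ X, ∀ y ∈ X, Relation.ReflTransGen (fun a b => a ∈ X ∧ b ∈ X ∧ A a b) x y

/-- `(X, A)` is reducible: digitally homotopy equivalent to a digital image
(a subset of some `ℤⁿ` with a `c_k`-adjacency) with strictly fewer points. -/
def Reducible (X : Set α) : Prop :=
  ∃ (n k : ℕ) (Y : Set (Fin n → ℤ)), 1 ≤ k ∧ k ≤ n ∧ Y.Finite ∧
    Y.ncard < X.ncard ∧ DigHomotopyEquiv A (cAdj n k) X Y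

/-- Value of a path at time `t`, extended past its endpoint by its final value. -/
def DigPath.eval (p : DigPath α) (t : ℤ) : α := p.toFun (min t (p.len : ℤ))

/-- `p` is a digital path in `(X, A)`. -/
def IsDigPath (X : Set α) (p : DigPath α) : Prop :=
  (∀ t ∈ Set.Icc (0 : ℤ) (p.len : ℤ), p.toFun t ∈ X) ∧
    ∀ t ∈ Set.Icc (0 : ℤ) (p.len : ℤ), ∀ t' ∈ Set.Icc (0 : ℤ) (p.len : ℤ),
      adjZ t t' → p.toFun t = p.toFun t' ∨ A (p.toFun t) (p.toFun t')

/-- Adjacency of digital paths in `PX`: after extending the shorter one by its final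
value, values at every time are equal or adjacent. -/
def pathAdj (p q : DigPath α) : Prop :=
  ∀ t ∈ Set.Icc (0 : ℤ) ((max p.len q.len : ℕ) : ℤ),
    p.eval t = q.eval t ∨ A (p.eval t) (q.eval t)

/-- Product adjacency on `X × X`. -/
def prodAdj (u v : α × α) : Prop :=
  u ≠ v ∧ (u.1 = v.1 ∨ A u.1 v.1) ∧ (u.2 = v.2 ∨ A u.2 v.2)

/-- `TCle A X k`: `X × X` is covered by `k` subsets, each admitting a digitally
continuous motion planning section of `π : PX → X × X`. -/
def TCle (X : Set α) (k : ℕ) : Prop :=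
  ∃ U : Fin k → Set (α × α),
    (⋃ j, U j) = X ×ˢ X ∧
    ∀ j, ∃ s : α × α → DigPath α,
      (∀ u ∈ U j, IsDigPath A X (s u)) ∧
      DigContinuousOn (prodAdj A) (pathAdj A) (U j) s ∧
      ∀ u ∈ U j, (s u).toFun 0 = u.1 ∧ (s u).toFun ((s u).len : ℤ) = u.2

/-- The digital topological complexity `TC(X, A)` (`∞` if no finite cover works). -/
noncomputable def digTC (X : Set α) : ℕ∞ :=
  sInf {N : ℕ∞ | ∃ k : ℕ, N = (k : ℕ∞) ∧ TCle A X k}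

/-- Membership in `Sₙ(X)`: the path lies in `X` and each marked point is in its image. -/
def InSn {n : ℕ} (X : Set α) (s : SnElt α n) : Prop :=
  IsDigPath A X s.path ∧
    ∀ i, ∃ t ∈ Set.Icc (0 : ℤ) (s.path.len : ℤ), s.path.toFun t = s.pts i

/-- Adjacency on `Sₙ(X)`. -/
def snAdj {n : ℕ} (s s' : SnElt α n) : Prop :=
  s ≠ s' ∧ pathAdj A s.path s'.path ∧
    ∀ i, s.pts i = s'.pts i ∨ A (s.pts i) (s'.pts i)

/-- Product adjacency on `Xⁿ`. -/
def prodAdjN {n : ℕ} (u v : Fin n → α) : Prop :=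
  u ≠ v ∧ ∀ i, u i = v i ∨ A (u i) (v i)

/-- `TCnle A X n k`: `Xⁿ` is covered by `k` subsets, each admitting a digitally
continuous section of `eₙ' : Sₙ(X) → Xⁿ`. -/
def TCnle (X : Set α) (n k : ℕ) : Prop :=
  ∃ U : Fin k → Set (Fin n → α),
    (⋃ j, U j) = {u : Fin n → α | ∀ i, u i ∈ X} ∧
    ∀ j, ∃ s : (Fin n → α) → SnElt α n,
      (∀ u ∈ U j, InSn A X (s u)) ∧
      DigContinuousOn (prodAdjN A) (snAdj A) (U j) s ∧
      ∀ u ∈ U j, (s u).pts = u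

/-- The digital higher topological complexity `TCₙ(X, A)`, i.e. the digital Schwarz
genus of `eₙ' : Sₙ(X) → Xⁿ`. -/
noncomputable def digTCn (X : Set α) (n : ℕ) : ℕ∞ :=
  sInf {N : ℕ∞ | ∃ k : ℕ, N = (k : ℕ∞) ∧ TCnle A X n k}

/-- `C` is a digital simple closed `A`-curve with `m` points. -/
def IsSimpleClosedCurve (C : Set α) (m : ℕ) : Prop :=
  4 ≤ m ∧ ∃ f : ℤ → α,
    C = f '' Set.Icc (0 : ℤ) ((m : ℤ) - 1) ∧
    Set.InjOn f (Set.Icc (0 : ℤ) ((m : ℤ) - 1)) ∧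
    (∀ t ∈ Set.Icc (0 : ℤ) ((m : ℤ) - 1), ∀ t' ∈ Set.Icc (0 : ℤ) ((m : ℤ) - 1),
      adjZ t t' → f t = f t' ∨ A (f t) (f t')) ∧
    A (f 0) (f ((m : ℤ) - 1)) ∧
    ∀ t ∈ Set.Icc (0 : ℤ) ((m : ℤ) - 1), ∀ t' ∈ Set.Icc (0 : ℤ) ((m : ℤ) - 1),
      A (f t) (f t') → f t' = f ((t - 1) % (m : ℤ)) ∨ f t' = f ((t + 1) % (m : ℤ))

/-- Adjacency on the digital `m`-cycle `ℤ/mℤ`: `i` adjacent to `i ± 1`. -/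
def cmAdj (m : ℕ) (i j : ZMod m) : Prop := i ≠ j ∧ (j = i + 1 ∨ i = j + 1)

/-- The set of digital `m`-loops in `(X, A)`. -/
def mLoops (X : Set α) (m : ℕ) : Set (ZMod m → α) :=
  {f | (∀ i, f i ∈ X) ∧ ∀ i j, cmAdj m i j → f i = f j ∨ A (f i) (f j)}

/-- `Lnum A X m` = the number of digital homotopy classes of `m`-loops in `(X, A)`. -/
noncomputable def Lnum (X : Set α) (m : ℕ) : ℕ :=
  Set.ncard {S : Set (ZMod m → α) | ∃ f ∈ mLoops A X m,
    S = {g | g ∈ mLoops A X m ∧ DigHomotopic (cmAdj m) A Set.univ X f g}}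

end

/-- Digital homotopy is symmetric. -/
theorem DigHomotopic.symm {α β : Type} {A : α → α → Prop} {B : β → β → Prop}
    {X : Set α} {Y : Set β} {f g : α → β} (h : DigHomotopic A B X Y f g) :
    DigHomotopic A B X Y g f := by
  obtain ⟨m, F, hmaps, hzero, hend, hcont, hpath⟩ := h
  have hrev : ∀ t ∈ Set.Icc (0 : ℤ) m, (m : ℤ) - t ∈ Set.Icc (0 : ℤ) m := by
    rintro t ⟨h0, hm⟩
    constructor <;> omega
  refine ⟨m, fun x t => F x (m - t), fun x hx t ht => hmaps x hx _ (hrev t ht), ?_, ?_,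
    fun t ht => hcont _ (hrev t ht), fun x hx t ht t' ht' hadj => ?_⟩
  · simpa using hend
  · simpa using hzero
  · refine hpath x hx _ (hrev t ht) _ (hrev t' ht') ?_
    unfold adjZ at *
    rwa [sub_sub_sub_cancel_left, abs_sub_comm]

/-- A contractible digital image is homotopy equivalent to one of its points. -/
theorem DigContractible.exists_digHomotopyEquiv_singleton {α : Type} {A : α → α → Prop}
    {X : Set α} (h : DigContractible A X) : ∃ x₀ ∈ X, DigHomotopyEquiv A A X {x₀} := by
  obtain ⟨x₀, hx₀, hhom⟩ := h
  refine ⟨x₀, hx₀, fun _ => x₀, fun _ _ => rfl, fun _ _ _ _ _ => Or.inl rfl, id, ?_, ?_,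
    hhom.symm, 0, fun _ _ => x₀, fun _ _ _ _ => rfl, fun _ _ => rfl, fun _ hx => hx.symm,
    fun _ _ _ _ _ _ _ => Or.inl rfl, fun _ _ _ _ _ _ _ => Or.inl rfl⟩
  · rintro _ rfl
    exact hx₀
  · rintro x rfl y rfl _
    exact Or.inl rfl

/-- a κ-connected, κ-contractible finite digital image with more than
one point is reducible. -/
theorem stmt_0 (n k : ℕ) (hk1 : 1 ≤ k) (hkn : k ≤ n)
    (X : Set (Fin n → ℤ)) (hfin : X.Finite) (hcard : 1 < X.ncard)
    (hconn : DigConnected (cAdj n k) X)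
    (hcontr : DigContractible (cAdj n k) X) :
    Reducible (cAdj n k) X := by
  obtain ⟨x₀, -, hequiv⟩ := hcontr.exists_digHomotopyEquiv_singleton
  exact ⟨n, k, {x₀}, hk1, hkn, Set.finite_singleton x₀, by rwa [Set.ncard_singleton], hequiv⟩
end

section
/- Let X ⊆ ℤ be a digitally connected finite digital image with 2-adjacency. Then TC(X,2) = 1. -/
theorem adjZ_iff {a b : ℤ} : adjZ a b ↔ a = b + 1 ∨ b = a + 1 := by
  rw [adjZ, abs_eq zero_le_one]
  omega

/-- A digitally connected subset of `ℤ` is order-connected. -/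
theorem DigConnected.mem_of_mem_uIcc {X : Set ℤ} (hX : DigConnected adjZ X) {a b c : ℤ}
    (ha : a ∈ X) (hb : b ∈ X) (hc : c ∈ Set.uIcc a b) : c ∈ X := by
  have key : ∀ d, Relation.ReflTransGen (fun x y => x ∈ X ∧ y ∈ X ∧ adjZ x y) a d →
      c ∈ Set.uIcc a d → c ∈ X := by
    intro d hd
    induction hd with
    | refl =>
      intro h
      rw [Set.uIcc_self, Set.mem_singleton_iff] at h
      exact h ▸ ha
    | @tail x y _ hxy ih =>
      obtain ⟨-, hy, hadj⟩ := hxy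
      intro h
      by_cases hcy : c = y
      · exact hcy ▸ hy
      · apply ih
        rw [Set.mem_uIcc] at h ⊢
        rw [adjZ_iff] at hadj
        omega
  exact key b (hX a ha b hb) hc

/-- The path from `u.1` to `u.2` in `ℤ` moving with unit speed: at time `t` it is at the point of
`[u.1 - t, u.1 + t]` closest to `u.2`. -/
def straightPath (u : ℤ × ℤ) : DigPath ℤ where
  len := (u.2 - u.1).natAbs
  toFun t := max (u.1 - t) (min (u.1 + t) u.2)

theorem straightPath_eval (u : ℤ × ℤ) {t : ℤ} (ht : 0 ≤ t) :
    (straightPath u).eval t = max (u.1 - t) (min (u.1 + t) u.2) := by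
  simp only [straightPath, DigPath.eval]
  omega

theorem straightPath_zero (u : ℤ × ℤ) : (straightPath u).toFun 0 = u.1 := by
  simp only [straightPath]
  omega

theorem straightPath_len (u : ℤ × ℤ) :
    (straightPath u).toFun ((straightPath u).len : ℤ) = u.2 := by
  simp only [straightPath]
  omega

theorem DigConnected.isDigPath_straightPath {X : Set ℤ} (hX : DigConnected adjZ X) {u : ℤ × ℤ}
    (hu : u ∈ X ×ˢ X) : IsDigPath adjZ X (straightPath u) := by
  refine ⟨fun t ht => hX.mem_of_mem_uIcc hu.1 hu.2 ?_, fun t _ t' _ h => ?_⟩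
  · simp only [straightPath, Set.mem_Icc, Set.mem_uIcc] at ht ⊢
    omega
  · simp only [straightPath, adjZ_iff] at h ⊢
    omega

theorem pathAdj_straightPath {u v : ℤ × ℤ} (h : prodAdj adjZ u v) :
    pathAdj adjZ (straightPath u) (straightPath v) := by
  obtain ⟨-, h₁, h₂⟩ := h
  intro t ht
  rw [straightPath_eval u ht.1, straightPath_eval v ht.1]
  simp only [adjZ_iff] at h₁ h₂ ⊢
  omega

theorem DigConnected.TCle_one {X : Set ℤ} (hX : DigConnected adjZ X) : TCle adjZ X 1 :=
  ⟨fun _ => X ×ˢ X, Set.iUnion_const _, fun _ => ⟨straightPath,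
    fun _ hu => hX.isDigPath_straightPath hu,
    fun _ _ _ _ h => Or.inr (pathAdj_straightPath h),
    fun u _ => ⟨straightPath_zero u, straightPath_len u⟩⟩⟩

theorem TCle.pos {α : Type} {A : α → α → Prop} {X : Set α} {k : ℕ} (hX : X.Nonempty)
    (h : TCle A X k) : 0 < k := by
  obtain ⟨U, hU, -⟩ := h
  obtain ⟨x, hx⟩ := hX
  have hmem : (x, x) ∈ ⋃ j, U j := hU ▸ ⟨hx, hx⟩
  obtain ⟨j, -⟩ := Set.mem_iUnion.mp hmem
  exact j.pos

/-- a digitally connected finite digital image `X ⊆ ℤ` has `TC(X,2) = 1`. -/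
theorem stmt_5 (X : Set ℤ) (hfin : X.Finite) (hne : X.Nonempty)
    (hconn : DigConnected adjZ X) :
    digTC adjZ X = 1 := by
  refine le_antisymm (sInf_le ⟨1, rfl, hconn.TCle_one⟩) (le_sInf ?_)
  rintro _ ⟨k, rfl, hk⟩
  exact_mod_cast hk.pos hne
end

section
/- Let C_m ⊆ ℤ² be a nonempty κ-connected digital simple closed κ-curve with m points, where κ ∈ {4,8}. If m = 4 then TC(C_m,κ) = 1, and if m > 5 then TC(C_m,κ) = 2. -/
/-- `i` and `j` are equal or neighbours on the cycle `ZMod m`. -/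
def CycNear (m : ℕ) (i j : ZMod m) : Prop := j = i ∨ j = i + 1 ∨ i = j + 1

instance (m : ℕ) (i j : ZMod m) : Decidable (CycNear m i j) := by
  unfold CycNear; infer_instance

theorem CycNear.symm {m : ℕ} {i j : ZMod m} (h : CycNear m i j) : CycNear m j i := by
  unfold CycNear at *; grind

theorem cycNear_iff_exists {m : ℕ} {i j : ZMod m} :
    CycNear m i j ↔ ∃ c : ℤ, |c| ≤ 1 ∧ j = i + (c : ZMod m) := by
  constructor
  · rintro (h | h | h)
    · exact ⟨0, by simp, by simp [h]⟩
    · exact ⟨1, by simp, by simp [h]⟩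
    · exact ⟨-1, by simp, by simp [h]⟩
  · rintro ⟨c, hc, rfl⟩
    have : c = -1 ∨ c = 0 ∨ c = 1 := by rw [abs_le] at hc; omega
    rcases this with rfl | rfl | rfl <;> simp [CycNear]

theorem adjK_symm (κ : ℕ) {p q : ℤ × ℤ} (h : adjK κ p q) : adjK κ q p := by
  unfold adjK at *
  split_ifs at *
  · rcases h with ⟨h, h'⟩ | ⟨h, h'⟩
    · exact Or.inl ⟨by rwa [abs_sub_comm], h'.symm⟩
    · exact Or.inr ⟨h.symm, by rwa [abs_sub_comm]⟩
  · exact ⟨h.1.symm, by rw [abs_sub_comm]; exact h.2.1, by rw [abs_sub_comm]; exact h.2.2⟩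

/-- `g` parametrizes `C` as a cycle of length `m`. -/
structure IsCycleParam {α : Type} (A : α → α → Prop) (C : Set α) (m : ℕ) (g : ZMod m → α) :
    Prop where
  inj : Function.Injective g
  range_eq : Set.range g = C
  near_iff : ∀ i j, (g i = g j ∨ A (g i) (g j)) ↔ CycNear m i j

theorem IsSimpleClosedCurve.exists_param {α : Type} {A : α → α → Prop}
    (hA : ∀ x y, A x y → A y x) {C : Set α} {m : ℕ} (hC : IsSimpleClosedCurve A C m) :
    ∃ g : ZMod m → α, IsCycleParam A C m g := by
  obtain ⟨hm, f, hCf, hinj, hcont, hclose, hnbr⟩ := hC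
  have : NeZero m := ⟨by omega⟩
  have hmem : ∀ i : ZMod m, (i.val : ℤ) ∈ Set.Icc (0 : ℤ) ((m : ℤ) - 1) := fun i => by
    have := i.val_lt
    constructor <;> omega
  have hmemod : ∀ t : ℤ, t % (m : ℤ) ∈ Set.Icc (0 : ℤ) ((m : ℤ) - 1) := fun t => by
    have := Int.emod_nonneg t (b := m) (by omega)
    have := Int.emod_lt_of_pos t (b := m) (by omega)
    constructor <;> omega
  have hg : Function.Injective fun i : ZMod m => f i.val := fun i j h => by
    have := hinj (hmem i) (hmem j) h
    exact ZMod.val_injective m (by exact_mod_cast this)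
  have hval : ∀ (j : ZMod m) (t : ℤ), f j.val = f (t % m) → j = (t : ZMod m) := fun j t h => by
    have h := congrArg (Int.cast : ℤ → ZMod m) (hinj (hmem j) (hmemod t) h)
    simpa using h
  have hsucc : ∀ i : ZMod m, f i.val = f (i + 1).val ∨ A (f i.val) (f (i + 1).val) := fun i => by
    by_cases hi : i.val + 1 < m
    · have h1 : (i + 1).val = i.val + 1 := by
        have : Fact (1 < m) := ⟨by omega⟩
        rw [ZMod.val_add_of_lt] <;> rw [ZMod.val_one]
        exact hi
      rw [h1]
      refine hcont _ (hmem i) _ ?_ ?_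
      · constructor <;> push_cast <;> omega
      · simp [adjZ]
    · have hi' : i.val + 1 = m := by have := i.val_lt; omega
      have h0 : i + 1 = 0 := by
        have := congrArg (Nat.cast : ℕ → ZMod m) hi'
        simpa using this
      have h2 : (i.val : ℤ) = (m : ℤ) - 1 := by omega
      rw [h0, h2]
      exact Or.inr (hA _ _ (by simpa using hclose))
  refine ⟨fun i => f i.val, hg, ?_, fun i j => ⟨?_, ?_⟩⟩
  · rw [hCf]
    ext x
    constructor
    · rintro ⟨i, rfl⟩
      exact ⟨_, hmem i, rfl⟩
    · rintro ⟨t, ht, rfl⟩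
      refine ⟨(t : ZMod m), ?_⟩
      have : (((t : ZMod m)).val : ℤ) = t := by
        rw [ZMod.val_intCast, Int.emod_eq_of_lt ht.1 (by have := ht.2; omega)]
      simp only [this]
  · rintro (h | h)
    · exact Or.inl (hg h).symm
    · rcases hnbr _ (hmem i) _ (hmem j) h with h | h
      · have := hval _ _ h
        refine Or.inr (Or.inr ?_)
        simp [this]
      · have := hval _ _ h
        refine Or.inr (Or.inl ?_)
        simp [this]
  · rintro (rfl | rfl | rfl)
    · exact Or.inl rfl
    · exact hsucc i
    · exact (hsucc j).imp Eq.symm (hA _ _)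

section

variable {α : Type} {A : α → α → Prop} {C : Set α} {m : ℕ} {g : ZMod m → α}

theorem IsCycleParam.leftInverse (hg : IsCycleParam A C m g) :
    Function.LeftInverse (Function.invFun g) g :=
  Function.leftInverse_invFun hg.inj

theorem IsCycleParam.apply_invFun (hg : IsCycleParam A C m g) {x : α} (hx : x ∈ C) :
    g (Function.invFun g x) = x :=
  Function.invFun_eq (by rwa [← hg.range_eq] at hx)

theorem IsCycleParam.near_invFun (hg : IsCycleParam A C m g) {x y : α} (hx : x ∈ C)
    (hy : y ∈ C) (h : x = y ∨ A x y) :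
    CycNear m (Function.invFun g x) (Function.invFun g y) := by
  rw [← hg.near_iff, hg.apply_invFun hx, hg.apply_invFun hy]
  exact h

/-- Motion planners on a cycle may be given in terms of indices. -/
theorem IsCycleParam.tcle_of_planner (hg : IsCycleParam A C m g) {k : ℕ}
    (V : Fin k → Set (ZMod m × ZMod m)) (hV : ∀ i j, ∃ a, (i, j) ∈ V a)
    (len : ZMod m → ZMod m → ℕ) (p : ZMod m → ZMod m → ℤ → ZMod m)
    (hstep : ∀ i j, ∀ t : ℤ, CycNear m (p i j t) (p i j (t + 1)))
    (hzero : ∀ i j, p i j 0 = i) (hlast : ∀ i j, p i j (len i j) = j)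
    (hnear : ∀ a i j i' j', (i, j) ∈ V a → (i', j') ∈ V a → CycNear m i i' → CycNear m j j' →
      ∀ t : ℤ, 0 ≤ t → CycNear m (p i j (min t (len i j))) (p i' j' (min t (len i' j')))) :
    TCle A C k := by
  set q := Function.invFun g with hq
  refine ⟨fun a => {u | u ∈ C ×ˢ C ∧ (q u.1, q u.2) ∈ V a}, ?_, fun a => ?_⟩
  · ext u
    simp only [Set.mem_iUnion, Set.mem_ofPred_eq]
    exact ⟨fun ⟨_, h, _⟩ => h, fun h => (hV (q u.1) (q u.2)).imp fun _ h' => ⟨h, h'⟩⟩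
  refine ⟨fun u => ⟨len (q u.1) (q u.2), fun t => g (p (q u.1) (q u.2) t)⟩, ?_, ?_, ?_⟩
  · intro u _
    refine ⟨fun t _ => hg.range_eq ▸ Set.mem_range_self _, fun t _ t' _ htt => ?_⟩
    rw [hg.near_iff]
    have : t' = t + 1 ∨ t = t' + 1 := by
      unfold adjZ at htt
      rw [abs_eq (by norm_num)] at htt
      omega
    rcases this with rfl | rfl
    · exact hstep _ _ _
    · exact (hstep _ _ _).symm
  · intro u hu u' hu' h
    refine Or.inr fun t ht => ?_
    simp only [DigPath.eval]
    rw [hg.near_iff]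
    exact hnear a _ _ _ _ hu.2 hu'.2 (hg.near_invFun hu.1.1 hu'.1.1 h.2.1)
      (hg.near_invFun hu.1.2 hu'.1.2 h.2.2) t ht.1
  · intro u hu
    simp only [hzero, hlast]
    exact ⟨hg.apply_invFun hu.1.1, hg.apply_invFun hu.1.2⟩

theorem Int.eq_of_cast_eq_of_abs_sub_lt {a b : ℤ} (h : (a : ZMod m) = b) (hab : |a - b| < m) :
    a = b := by
  have h1 : (m : ℤ) ∣ a - b := by
    rw [← ZMod.intCast_zmod_eq_zero_iff_dvd]
    push_cast
    rw [h, sub_self]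
  have := Int.eq_zero_of_abs_lt_dvd h1 hab
  omega

/-- A cycle of length at least five is covered by two planners going counterclockwise, according
to whether the target is at most two steps behind the source. -/
theorem IsCycleParam.tcle_two (hg : IsCycleParam A C m g) (hm : 5 ≤ m) : TCle A C 2 := by
  have : NeZero m := ⟨by omega⟩
  refine hg.tcle_of_planner
    (fun a => {u | if a = 0 then (u.2 - u.1).val + 3 ≤ m else m < (u.2 - u.1).val + 3})
    (fun i j => ?_) (fun i j => (j - i).val) (fun i j t => i + (t : ZMod m)) ?_ ?_ ?_ ?_
  · by_cases h : (j - i).val + 3 ≤ m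
    · exact ⟨0, by simpa using h⟩
    · exact ⟨1, by simpa using h⟩
  · intro i j t
    refine Or.inr (Or.inl ?_)
    push_cast
    ring
  · simp
  · simp
  · intro a i j i' j' hu hu' hi hj t ht
    rw [cycNear_iff_exists] at hi hj
    obtain ⟨c, hc, rfl⟩ := hi
    obtain ⟨e, he, rfl⟩ := hj
    set d := (j - i).val with hd
    set d' := (j + (e : ZMod m) - (i + (c : ZMod m))).val with hd'
    have hdm : d < m := ZMod.val_lt _
    have hdm' : d' < m := ZMod.val_lt _
    have hclose : |(d' : ℤ) - d| + 3 ≤ m := by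
      simp only [Set.mem_ofPred_eq, ← hd, ← hd'] at hu hu'
      rw [← le_sub_iff_add_le, abs_le]
      split_ifs at hu hu' <;> constructor <;> omega
    rw [abs_le] at hc he
    have hdd : (d' : ℤ) = d + e - c := by
      refine Int.eq_of_cast_eq_of_abs_sub_lt (m := m) ?_ ?_
      · push_cast
        rw [hd, hd', ZMod.natCast_zmod_val, ZMod.natCast_zmod_val]
        ring
      · rw [← le_sub_iff_add_le, abs_le] at hclose
        rw [abs_lt]
        omega
    rw [cycNear_iff_exists]
    refine ⟨c + min t d' - min t d, ?_, ?_⟩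
    · rw [abs_le]
      omega
    · push_cast
      ring

/-- A cycle of length four has a global planner, contracting both ends to the index `0`. -/
theorem IsCycleParam.tcle_one {g : ZMod 4 → α} (hg : IsCycleParam A C 4 g) : TCle A C 1 := by
  obtain ⟨c, hc, hc1, hc0⟩ : ∃ c : ZMod 4 → ZMod 4,
      (∀ i j, CycNear 4 i j → CycNear 4 (c i) (c j)) ∧ (∀ i, CycNear 4 i (c i)) ∧
      ∀ i, CycNear 4 (c i) 0 :=
    ⟨fun i => if i = 1 ∨ i = 2 then 1 else 0, by decide, by decide, by decide⟩
  refine hg.tcle_of_planner (fun _ => Set.univ) (fun _ _ => ⟨0, trivial⟩) (fun _ _ => 4)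
    (fun i j t => if t ≤ 0 then i else if t = 1 then c i else if t = 2 then 0 else
      if t = 3 then c j else j) ?_ ?_ ?_ ?_
  · intro i j t
    have h : t < 0 ∨ t = 0 ∨ t = 1 ∨ t = 2 ∨ t = 3 ∨ 4 ≤ t := by omega
    rcases h with h | rfl | rfl | rfl | rfl | h
    · rw [if_pos h.le, if_pos (by omega)]
      exact Or.inl rfl
    · simpa using hc1 i
    · simpa using hc0 i
    · simpa using (hc0 j).symm
    · simpa using (hc1 j).symm
    · rw [if_neg (by omega), if_neg (by omega), if_neg (by omega), if_neg (by omega),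
        if_neg (by omega), if_neg (by omega), if_neg (by omega), if_neg (by omega)]
      exact Or.inl rfl
  · simp
  · simp
  · intro _ i j i' j' _ _ hi hj t _
    split_ifs
    · exact hi
    · exact hc _ _ hi
    · exact Or.inl rfl
    · exact hc _ _ hj
    · exact hj

theorem valMinAbs_intCast_of_abs_le_one [NeZero m] (hm : 3 ≤ m) {c : ℤ} (hc : |c| ≤ 1) :
    (c : ZMod m).valMinAbs = c := by
  rw [abs_le] at hc
  rw [ZMod.valMinAbs_spec]
  exact ⟨rfl, by omega, by omega⟩

/-- The signed step from `i` to `j` is short when they are near. -/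
theorem CycNear.abs_valMinAbs_le [NeZero m] (hm : 3 ≤ m) {i j : ZMod m} (h : CycNear m i j) :
    |(j - i).valMinAbs| ≤ 1 := by
  obtain ⟨c, hc, rfl⟩ := cycNear_iff_exists.1 h
  rwa [add_sub_cancel_left, valMinAbs_intCast_of_abs_le_one hm hc]

/-- The total signed turning of a closed walk on a cycle of length at least five does not change
when all points of the walk move to near points. -/
theorem sum_valMinAbs_eq_of_cycNear [NeZero m] (hm : 5 ≤ m) {h h' : ZMod m → ZMod m}
    (hh : ∀ i, CycNear m (h i) (h (i + 1))) (hh' : ∀ i, CycNear m (h' i) (h' (i + 1)))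
    (hhh' : ∀ i, CycNear m (h i) (h' i)) :
    ∑ i, (h (i + 1) - h i).valMinAbs = ∑ i, (h' (i + 1) - h' i).valMinAbs := by
  have key : ∀ i, (h (i + 1) - h i).valMinAbs - (h' (i + 1) - h' i).valMinAbs =
      (h' i - h i).valMinAbs - (h' (i + 1) - h (i + 1)).valMinAbs := fun i => by
    have h1 := abs_le.1 ((hh i).abs_valMinAbs_le (by omega))
    have h2 := abs_le.1 ((hh' i).abs_valMinAbs_le (by omega))
    have h3 := abs_le.1 ((hhh' i).abs_valMinAbs_le (by omega))
    have h4 := abs_le.1 ((hhh' (i + 1)).abs_valMinAbs_le (by omega))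
    refine Int.eq_of_cast_eq_of_abs_sub_lt (m := m) ?_ ?_
    · push_cast
      ring
    · rw [abs_lt]
      omega
  have hshift : ∑ i, (h' (i + 1) - h (i + 1)).valMinAbs = ∑ i, (h' i - h i).valMinAbs :=
    Equiv.sum_comp (Equiv.addRight (1 : ZMod m)) fun i => (h' i - h i).valMinAbs
  rw [← sub_eq_zero, ← Finset.sum_sub_distrib, Finset.sum_congr rfl fun i _ => key i,
    Finset.sum_sub_distrib, hshift, sub_self]

/-- The identity of a cycle of length at least five is not homotopic to a constant map. -/
theorem not_cyc_contractible [NeZero m] (hm : 5 ≤ m) (h : ℕ → ZMod m → ZMod m) (N : ℕ) (c : ZMod m)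
    (h0 : ∀ i, h 0 i = i) (hN : ∀ i, h N i = c)
    (hh : ∀ n i, CycNear m (h n i) (h n (i + 1)))
    (hstep : ∀ n i, CycNear m (h n i) (h (n + 1) i)) : False := by
  have hinv : ∀ n, ∑ i, (h n (i + 1) - h n i).valMinAbs = ∑ i, (h 0 (i + 1) - h 0 i).valMinAbs := by
    intro n
    induction n with
    | zero => rfl
    | succ n ih => rw [← ih, sum_valMinAbs_eq_of_cycNear hm (hh n) (hh (n + 1)) (hstep n)]
  have h1 : ((1 : ZMod m)).valMinAbs = 1 := by
    simpa using valMinAbs_intCast_of_abs_le_one (m := m) (c := 1) (by omega) (by simp)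
  have := hinv N
  simp [hN, h0, h1] at this
  omega

theorem IsCycleParam.not_tcle_one (hg : IsCycleParam A C m g) (hm : 5 ≤ m) : ¬ TCle A C 1 := by
  have : NeZero m := ⟨by omega⟩
  rintro ⟨U, hU, hs⟩
  obtain ⟨s, hpath, hcont, hend⟩ := hs 0
  have hmemC : ∀ i, g i ∈ C := fun i => hg.range_eq ▸ Set.mem_range_self _
  have hmem : ∀ i, (g i, g 0) ∈ U 0 := fun i => by
    have : (g i, g 0) ∈ ⋃ j, U j := hU ▸ ⟨hmemC i, hmemC 0⟩
    obtain ⟨j, hj⟩ := Set.mem_iUnion.1 this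
    rwa [Subsingleton.elim j 0] at hj
  set P : ZMod m → DigPath α := fun i => s (g i, g 0) with hP
  set q := Function.invFun g with hq
  have hev : ∀ i (n : ℕ), (P i).eval n ∈ C := fun i n =>
    (hpath _ (hmem i)).1 _ ⟨by positivity, min_le_right _ _⟩
  have hlast : ∀ i (n : ℕ), (P i).len ≤ n → (P i).eval n = g 0 := fun i n hn => by
    rw [DigPath.eval, min_eq_right (by exact_mod_cast hn)]
    exact (hend _ (hmem i)).2
  refine not_cyc_contractible hm (fun n i => q ((P i).eval n)) (∑ i, (P i).len) 0 ?_ ?_ ?_ ?_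
  · intro i
    have : (P i).eval ((0 : ℕ) : ℤ) = g i := by
      rw [DigPath.eval, min_eq_left (by positivity)]
      exact (hend _ (hmem i)).1
    simp only [this]
    exact hg.leftInverse i
  · intro i
    have hle : (P i).len ≤ ∑ i, (P i).len :=
      Finset.single_le_sum (f := fun i => (P i).len) (fun _ _ => Nat.zero_le _) (Finset.mem_univ i)
    simp only [hlast i _ hle]
    exact hg.leftInverse 0
  · intro n i
    refine hg.near_invFun (hev _ _) (hev _ _) ?_
    have hadj : prodAdj A (g i, g 0) (g (i + 1), g 0) := by
      refine ⟨fun h => ?_, (hg.near_iff i (i + 1)).2 (Or.inr (Or.inl rfl)), Or.inl rfl⟩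
      have : Fact (1 < m) := ⟨by omega⟩
      have := hg.inj (Prod.ext_iff.1 h).1
      simp at this
    rcases hcont _ (hmem i) _ (hmem (i + 1)) hadj with h | h
    · exact Or.inl (congrArg (fun p => p.eval n) h)
    · by_cases hn : n ≤ max (P i).len (P (i + 1)).len
      · exact h n ⟨by positivity, by exact_mod_cast hn⟩
      · rw [hlast i n (by omega), hlast (i + 1) n (by omega)]
        exact Or.inl rfl
  · intro n i
    refine hg.near_invFun (hev _ _) (hev _ _) ?_
    by_cases hn : n + 1 ≤ (P i).len
    · have e1 : min (n : ℤ) (P i).len = n := min_eq_left (by omega)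
      have e2 : min ((n + 1 : ℕ) : ℤ) (P i).len = n + 1 := by
        rw [min_eq_left (by omega)]; push_cast; rfl
      simp only [DigPath.eval, e1, e2]
      have hn' : (n : ℤ) + 1 ≤ (s (g i, g 0)).len := by exact_mod_cast hn
      exact (hpath _ (hmem i)).2 _ ⟨by omega, by omega⟩ _ ⟨by omega, by omega⟩ (by simp [adjZ])
    · rw [hlast i n (by omega), hlast i (n + 1) (by omega)]
      exact Or.inl rfl

theorem not_tcle_zero (hC : C.Nonempty) : ¬ TCle A C 0 := by
  rintro ⟨U, hU, -⟩
  obtain ⟨x, hx⟩ := hC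
  have : (x, x) ∈ ⋃ j, U j := hU ▸ ⟨hx, hx⟩
  simp at this

theorem digTC_eq_of_tcle {k : ℕ} (h : TCle A C k) (h' : ∀ l < k, ¬ TCle A C l) :
    digTC A C = k := by
  refine le_antisymm (sInf_le ⟨k, rfl, h⟩) (le_sInf ?_)
  rintro _ ⟨l, rfl, hl⟩
  by_contra hlt
  exact h' l (by exact_mod_cast not_le.1 hlt) hl

end

/-- for a nonempty κ-connected digital simple closed κ-curve `C_m ⊆ ℤ²`,
κ ∈ {4,8}: if `m = 4` then `TC(C_m,κ) = 1`, and if `m > 5` then `TC(C_m,κ) = 2`. -/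
theorem stmt_6 (κ : ℕ) (hκ : κ = 4 ∨ κ = 8) (m : ℕ) (C : Set (ℤ × ℤ))
    (hC : IsSimpleClosedCurve (adjK κ) C m) (hne : C.Nonempty)
    (hconn : DigConnected (adjK κ) C) :
    (m = 4 → digTC (adjK κ) C = 1) ∧ (5 < m → digTC (adjK κ) C = 2) := by
  obtain ⟨g, hg⟩ := hC.exists_param fun _ _ => adjK_symm κ
  constructor
  · rintro rfl
    refine digTC_eq_of_tcle (k := 1) hg.tcle_one fun l hl => ?_
    obtain rfl : l = 0 := by omega
    exact not_tcle_zero hne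
  · intro hm
    refine digTC_eq_of_tcle (k := 2) (hg.tcle_two hm.le) fun l hl => ?_
    obtain rfl | rfl : l = 0 ∨ l = 1 := by omega
    · exact not_tcle_zero hne
    · exact hg.not_tcle_one hm.le
end

section
/- Let X ⊆ ℤ² be a digitally connected digital image with m points. If m < 6 then TC(X,8) = 1, and if m < 8 then TC(X,4) = 1. -/
/-- A self-map of the digital image `X` that is homotopic to the identity in one step and
identifies two points. -/
def HasFold {α : Type} (A : α → α → Prop) (X : Set α) : Prop :=
  ∃ f : α → α, DigMapsTo X X f ∧ DigContinuousOn A A X f ∧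
    (∀ x ∈ X, f x = x ∨ A x (f x)) ∧ ∃ x ∈ X, ∃ y ∈ X, x ≠ y ∧ f x = f y

section General

variable {α : Type} {A : α → α → Prop} {X : Set α}

theorem DigConnected.image {f : α → α} (hX : DigConnected A X) (hf : DigContinuousOn A A X f) :
    DigConnected A (f '' X) := by
  rintro _ ⟨x, hx, rfl⟩ _ ⟨y, hy, rfl⟩
  have h := hX x hx y hy
  clear hy
  induction h with
  | refl => exact .refl
  | tail _ hbc ih =>
    rcases hf _ hbc.1 _ hbc.2.1 hbc.2.2 with h | h
    · exact h ▸ ih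
    · exact ih.tail ⟨⟨_, hbc.1, rfl⟩, ⟨_, hbc.2.1, rfl⟩, h⟩

theorem DigConnected.exists_adj (hX : DigConnected A X) (hn : X.Nontrivial) {p : α}
    (hp : p ∈ X) : ∃ q ∈ X, A p q := by
  obtain ⟨y, hy, hyp⟩ := hn.exists_ne p
  rcases (hX p hp y hy).cases_head with h | ⟨c, hc, -⟩
  · exact absurd h.symm hyp
  · exact ⟨c, hc.2.1, hc.2.2⟩

theorem DigContractible.of_fold (hA : ∀ x y, A x y → A y x) {f : α → α} (hf : DigMapsTo X X f)
    (hfc : DigContinuousOn A A X f) (hf1 : ∀ x ∈ X, f x = x ∨ A x (f x))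
    (h : DigContractible A (f '' X)) : DigContractible A X := by
  obtain ⟨x₀, hx₀, m, G, hG, hG0, hGm, hGc, hGp⟩ := h
  have hsub : f '' X ⊆ X := Set.image_subset_iff.2 hf
  have hfX : ∀ x ∈ X, f x ∈ f '' X := fun x hx => ⟨x, hx, rfl⟩
  refine ⟨x₀, hsub hx₀, m + 1, fun x t => if t ≤ 0 then x else G (f x) (t - 1),
    ?_, ?_, ?_, ?_, ?_⟩
  · intro x hx t ht
    dsimp only
    split_ifs with h
    · exact hx
    · exact hsub (hG _ (hfX x hx) _ (by simp at ht ⊢; omega))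
  · intro x _
    simp
  · intro x hx
    have : ¬ ((m : ℤ) + 1 ≤ 0) := by omega
    simpa [this] using hGm _ (hfX x hx)
  · intro t ht x hx y hy hxy
    dsimp only
    split_ifs with h
    · exact Or.inr hxy
    · rcases hfc x hx y hy hxy with h' | h'
      · exact Or.inl (by rw [h'])
      · exact hGc (t - 1) (by simp at ht ⊢; omega) _ (hfX x hx) _ (hfX y hy) h'
  · intro x hx t ht t' ht' htt
    have hstep : ∀ s : ℤ, s = 1 → G (f x) (s - 1) = f x := by
      rintro s rfl
      simpa using hG0 _ (hfX x hx)
    unfold adjZ at htt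
    simp only [Set.mem_Icc, Nat.cast_add, Nat.cast_one] at ht ht'
    have hcases := (abs_eq zero_le_one).1 htt
    dsimp only
    split_ifs with h h' h'
    · exact Or.inl rfl
    · rw [hstep t' (by omega)]
      exact (hf1 x hx).imp Eq.symm id
    · rw [hstep t (by omega)]
      exact (hf1 x hx).imp id (hA _ _)
    · refine hGp _ (hfX x hx) _ ?_ _ ?_ ?_
      · simp; omega
      · simp; omega
      · unfold adjZ
        rwa [sub_sub_sub_cancel_right]

theorem DigContractible.of_forall_hasFold (hA : ∀ x y, A x y → A y x) (N : ℕ)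
    (hfold : ∀ Y : Set α, Y.Finite → Y.Nontrivial → DigConnected A Y → Y.ncard ≤ N → HasFold A Y)
    (hfin : X.Finite) (hne : X.Nonempty) (hX : DigConnected A X) (hN : X.ncard ≤ N) :
    DigContractible A X := by
  induction hk : X.ncard using Nat.strong_induction_on generalizing X with
  | _ k ih =>
    rcases hne.exists_eq_singleton_or_nontrivial with ⟨x₀, rfl⟩ | hnt
    · refine ⟨x₀, rfl, 0, fun x _ => x, fun x hx _ _ => hx, fun _ _ => rfl,
        fun x hx => hx, fun _ _ x _ y _ h => Or.inr h, fun _ _ _ _ _ _ _ => Or.inl rfl⟩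
    · obtain ⟨f, hf, hfc, hf1, x, hx, y, hy, hxy, hfxy⟩ := hfold X hfin hnt hX hN
      have hlt : (f '' X).ncard < X.ncard := by
        refine lt_of_le_of_ne (Set.ncard_image_le hfin) fun h => hxy ?_
        exact (Set.ncard_image_iff hfin).1 h hx hy hfxy
      exact .of_fold hA hf hfc hf1
        (ih _ (hk ▸ hlt) (hfin.image f) (hne.image f) (hX.image hfc) (by omega) rfl)

theorem DigContractible.tcle_one (h : DigContractible A X) : TCle A X 1 := by
  obtain ⟨x₀, -, m, H, hH, hH0, hHm, hHc, hHp⟩ := h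
  refine ⟨fun _ => X ×ˢ X, Set.iUnion_const _, fun _ =>
    ⟨fun u => ⟨2 * m, fun t => if t ≤ m then H u.1 t else H u.2 (2 * m - t)⟩, ?_, ?_, ?_⟩⟩
  · rintro ⟨x, y⟩ ⟨hx, hy⟩
    have hxy : ∀ t : ℤ, t = m → H x t = H y t := by
      rintro t rfl
      rw [hHm x hx, hHm y hy]
    refine ⟨fun t ht => ?_, fun t ht t' ht' htt => ?_⟩
    · simp only [Set.mem_Icc, Nat.cast_mul, Nat.cast_ofNat] at ht
      dsimp only
      split_ifs with h
      · exact hH x hx t ⟨ht.1, h⟩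
      · exact hH y hy _ ⟨by omega, by omega⟩
    · simp only [Set.mem_Icc, Nat.cast_mul, Nat.cast_ofNat] at ht ht'
      have hc := (abs_eq zero_le_one).1 htt
      have hadj : ∀ a b : ℤ, (a - b = 1 ∨ a - b = -1) → adjZ a b :=
        fun a b h => (abs_eq zero_le_one).2 h
      dsimp only
      split_ifs with h h' h'
      · exact hHp x hx t ⟨ht.1, h⟩ t' ⟨ht'.1, h'⟩ htt
      · rw [hxy t (by omega)]
        exact hHp y hy t ⟨ht.1, h⟩ _ ⟨by omega, by omega⟩ (hadj _ _ (by omega))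
      · rw [hxy t' (by omega)]
        exact hHp y hy _ ⟨by omega, by omega⟩ t' ⟨ht'.1, h'⟩ (hadj _ _ (by omega))
      · exact hHp y hy _ ⟨by omega, by omega⟩ _ ⟨by omega, by omega⟩ (hadj _ _ (by omega))
  · rintro ⟨x, y⟩ ⟨hx, hy⟩ ⟨x', y'⟩ ⟨hx', hy'⟩ ⟨-, hxx, hyy⟩
    refine Or.inr fun t ht => ?_
    simp only [max_self, Set.mem_Icc, Nat.cast_mul, Nat.cast_ofNat] at ht
    have key : ∀ a ∈ X, ∀ b ∈ X, (a = b ∨ A a b) → ∀ r ∈ Set.Icc (0 : ℤ) m,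
        H a r = H b r ∨ A (H a r) (H b r) := by
      rintro a ha b hb (rfl | hab) r hr
      · exact Or.inl rfl
      · exact hHc r hr a ha b hb hab
    simp only [DigPath.eval, Nat.cast_mul, Nat.cast_ofNat, min_eq_left ht.2]
    split_ifs with h
    · exact key x hx x' hx' hxx t ⟨ht.1, h⟩
    · exact key y hy y' hy' hyy _ ⟨by omega, by omega⟩
  · rintro ⟨x, y⟩ ⟨hx, hy⟩
    refine ⟨by simpa using hH0 x hx, ?_⟩
    dsimp only
    split_ifs with h
    · have hm : m = 0 := by push_cast at h; omega
      subst hm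
      have h1 := hHm x hx
      have h2 := hHm y hy
      have h3 := hH0 y hy
      simp_all
    · simpa using hH0 y hy

theorem digTC_eq_one_of_contractible (hne : X.Nonempty) (h : DigContractible A X) :
    digTC A X = 1 := by
  refine le_antisymm (sInf_le ⟨1, by simp, h.tcle_one⟩) (le_sInf ?_)
  rintro _ ⟨k, rfl, U, hU, -⟩
  rcases Nat.eq_zero_or_pos k with rfl | hk
  · obtain ⟨x, hx⟩ := hne
    have : (x, x) ∈ ⋃ j, U j := hU ▸ ⟨hx, hx⟩
    simp at this
  · exact_mod_cast hk

theorem length_le_ncard (hfin : X.Finite) {l : List α} (hl : l.Nodup) (hX : ∀ x ∈ l, x ∈ X) :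
    l.length ≤ X.ncard := by
  classical
  rw [← List.toFinset_card_of_nodup hl, ← Set.ncard_coe_finset]
  exact Set.ncard_le_ncard (fun x hx => hX x (by simpa using hx)) hfin

/-- Moving a single point `p` onto an adjacent point `q` that is equal or adjacent to every
neighbour of `p`. -/
theorem HasFold.of_dominated {p q : α} (hA : ∀ x y, A x y → A y x) (hp : p ∈ X) (hq : q ∈ X)
    (hpq : A p q) (hne : p ≠ q) (h : ∀ r ∈ X, A p r → q = r ∨ A q r) : HasFold A X := by
  classical
  refine ⟨fun x => if x = p then q else x, ?_, ?_, ?_, p, hp, q, hq, hne, by simp⟩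
  · intro x hx
    dsimp only
    split_ifs <;> assumption
  · intro x hx y hy hxy
    dsimp only
    split_ifs with h1 h2 h2
    · exact Or.inl rfl
    · exact h y hy (h1 ▸ hxy)
    · exact (h x hx (hA _ _ (h2 ▸ hxy))).imp Eq.symm (hA _ _)
    · exact Or.inr hxy
  · intro x hx
    dsimp only
    split_ifs with h1
    · exact Or.inr (h1 ▸ hpq)
    · exact Or.inl rfl

end General

section Plane

variable {X : Set (ℤ × ℤ)}

theorem adj4_iff (a b c d : ℤ) : adj4 (a, b) (c, d) ↔
    ((a = c + 1 ∨ c = a + 1) ∧ b = d) ∨ (a = c ∧ (b = d + 1 ∨ d = b + 1)) := by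
  simp only [adj4, abs_eq zero_le_one]
  omega

theorem adj8_iff (a b c d : ℤ) : adj8 (a, b) (c, d) ↔
    ¬(a = c ∧ b = d) ∧ a ≤ c + 1 ∧ c ≤ a + 1 ∧ b ≤ d + 1 ∧ d ≤ b + 1 := by
  simp only [adj8, abs_le, ne_eq, Prod.mk.injEq]
  omega

theorem adj4_symm : ∀ p q, adj4 p q → adj4 q p := by
  rintro ⟨a, b⟩ ⟨c, d⟩
  simp only [adj4_iff]
  omega

theorem adj8_symm : ∀ p q, adj8 p q → adj8 q p := by
  rintro ⟨a, b⟩ ⟨c, d⟩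
  simp only [adj8_iff]
  omega

theorem exists_row_bounds (hfin : X.Finite) {c M : ℤ} (hc : (c, M) ∈ X) :
    ∃ a b, (a, M) ∈ X ∧ (b, M) ∈ X ∧ ∀ x, (x, M) ∈ X → a ≤ x ∧ x ≤ b := by
  have hrow : {x | (x, M) ∈ X}.Finite :=
    hfin.preimage (f := fun x => (x, M)) fun x _ y _ h => congrArg Prod.fst h
  obtain ⟨a, ha, hamin⟩ := Set.exists_min_image _ id hrow ⟨c, hc⟩
  obtain ⟨b, hb, hbmax⟩ := Set.exists_max_image _ id hrow ⟨c, hc⟩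
  exact ⟨a, b, ha, hb, fun x hx => ⟨hamin x hx, hbmax x hx⟩⟩

theorem exists_extreme_rows (hfin : X.Finite) (hne : X.Nonempty) :
    ∃ c M c' m, (c, M) ∈ X ∧ (c', m) ∈ X ∧ ∀ x y, (x, y) ∈ X → m ≤ y ∧ y ≤ M := by
  obtain ⟨⟨c, M⟩, hc, hmax⟩ := Set.exists_max_image X Prod.snd hfin hne
  obtain ⟨⟨c', m⟩, hc', hmin⟩ := Set.exists_min_image X Prod.snd hfin hne
  exact ⟨c, M, c', m, hc, hc', fun x y h => ⟨hmin _ h, hmax _ h⟩⟩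

/-- Pushing an initial segment of an extreme row into the next row. -/
theorem HasFold.of_row {M σ a c : ℤ} (hσ : σ = 1 ∨ σ = -1) (htop : ∀ x, (x, M + σ) ∉ X)
    (ha : (a, M) ∈ X) (hac : a ≤ c) (hc : (c + 1, M) ∉ X)
    (hpush : ∀ x ≤ c, (x, M) ∈ X → (x, M - σ) ∈ X) : HasFold adj4 X := by
  refine ⟨fun p => if p.2 = M ∧ p.1 ≤ c then (p.1, M - σ) else p, ?_, ?_, ?_,
    (a, M), ha, (a, M - σ), hpush a hac ha, ?_, ?_⟩
  · rintro ⟨x, y⟩ hx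
    dsimp only
    split_ifs with h
    · obtain ⟨rfl, h⟩ := h
      exact hpush x h hx
    · exact hx
  · rintro ⟨x, y⟩ hx ⟨x', y'⟩ hx' hadj
    rw [adj4_iff] at hadj
    have aux : ∀ x y, (x, y) ∈ X → y ≠ M + σ ∧ ¬(x = c + 1 ∧ y = M) := by
      refine fun x y h => ⟨?_, ?_⟩
      · rintro rfl
        exact htop x h
      · rintro ⟨rfl, rfl⟩
        exact hc h
    have h1 := aux x y hx
    have h2 := aux x' y' hx'
    dsimp only
    rcases hσ with rfl | rfl <;> rcases hadj with ⟨h3 | h3, h4⟩ | ⟨h3, h4 | h4⟩ <;>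
      split_ifs with h h' h' <;> rw [Prod.mk.injEq, adj4_iff] <;> omega
  · rintro ⟨x, y⟩ hx
    dsimp only
    split_ifs with h <;> rw [Prod.mk.injEq, adj4_iff] <;> omega
  · simp only [ne_eq, Prod.mk.injEq]
    omega
  · have : M - σ ≠ M := by omega
    simp [hac, this]

/-- In an image without folds, an extreme row contains three consecutive points, both its ends
have a neighbour in the next row, and some point of it does not. -/
theorem extreme_row_of_not_hasFold4 (hfin : X.Finite) (hfold : ¬ HasFold adj4 X)
    (hdeg : ∀ p ∈ X, ∀ q, ∃ r ∈ X, adj4 p r ∧ r ≠ q) {M σ c : ℤ} (hσ : σ = 1 ∨ σ = -1)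
    (htop : ∀ x, (x, M + σ) ∉ X) (hc : (c, M) ∈ X) :
    ∃ a b, a + 2 ≤ b ∧ (a, M) ∈ X ∧ (a + 1, M) ∈ X ∧ (a + 2, M) ∈ X ∧ (b, M) ∈ X ∧
      (a, M - σ) ∈ X ∧ (b, M - σ) ∈ X ∧ (∀ x, (x, M) ∈ X → a ≤ x ∧ x ≤ b) ∧
      ∃ e, (e, M) ∈ X ∧ (e, M - σ) ∉ X := by
  obtain ⟨a, b, ha, hb, hab⟩ := exists_row_bounds hfin hc
  have nbr : ∀ x y, (x, M) ∈ X →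
      (x + 1, M) ∈ X ∧ x + 1 ≠ y ∨ (x - 1, M) ∈ X ∧ x - 1 ≠ y ∨ (x, M - σ) ∈ X := by
    intro x y hx
    obtain ⟨⟨r, s⟩, hr, hadj, hne⟩ := hdeg _ hx (y, M)
    rw [adj4_iff] at hadj
    simp only [ne_eq, Prod.mk.injEq] at hne
    have hs : s ≠ M + σ := by
      rintro rfl
      exact htop r hr
    have : (r = x + 1 ∧ s = M) ∨ (r = x - 1 ∧ s = M) ∨ (r = x ∧ s = M - σ) := by omega
    rcases this with ⟨rfl, rfl⟩ | ⟨rfl, rfl⟩ | ⟨rfl, rfl⟩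
    · exact Or.inl ⟨hr, fun h => hne ⟨h, rfl⟩⟩
    · exact Or.inr (Or.inl ⟨hr, fun h => hne ⟨h, rfl⟩⟩)
    · exact Or.inr (Or.inr hr)
  have hfull : ∃ e, (e, M) ∈ X ∧ (e, M - σ) ∉ X := by
    by_contra! h
    exact hfold (.of_row hσ htop ha (hab b hb).1 (fun h => by have := (hab _ h).2; omega)
      fun x _ hx => h x hx)
  have ha' : (a, M - σ) ∈ X := by
    by_cases h1 : (a + 1, M) ∈ X
    · rcases nbr a (a + 1) ha with h | h | h
      · exact absurd rfl h.2
      · have := (hab _ h.1).1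
        omega
      · exact h
    · rcases nbr a a ha with h | h | h
      · exact absurd h.1 h1
      · have := (hab _ h.1).1
        omega
      · exact h
  have hb' : (b, M - σ) ∈ X := by
    by_cases h1 : (b - 1, M) ∈ X
    · rcases nbr b (b - 1) hb with h | h | h
      · have := (hab _ h.1).2
        omega
      · exact absurd rfl h.2
      · exact h
    · rcases nbr b b hb with h | h | h
      · have := (hab _ h.1).2
        omega
      · exact absurd h.1 h1
      · exact h
  have ha1 : (a + 1, M) ∈ X := by
    by_contra h
    refine hfold (.of_row hσ htop ha le_rfl h fun x hx hxX => ?_)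
    obtain rfl : x = a := le_antisymm hx (hab x hxX).1
    exact ha'
  have ha2 : (a + 2, M) ∈ X := by
    by_contra h
    have hbelow : (a + 1, M - σ) ∈ X := by
      rcases nbr (a + 1) a ha1 with h' | h' | h'
      · exact absurd (by simpa [add_assoc] using h'.1) h
      · omega
      · exact h'
    refine hfold (.of_row (c := a + 1) hσ htop ha (by omega) (by simpa [add_assoc] using h)
      fun x hx hxX => ?_)
    have := (hab x hxX).1
    obtain rfl | rfl : x = a ∨ x = a + 1 := by omega
    · exact ha'
    · exact hbelow
  exact ⟨a, b, (hab _ ha2).2, ha, ha1, ha2, hb, ha', hb', hab, hfull⟩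

theorem hasFold_adj4 (hfin : X.Finite) (hnt : X.Nontrivial) (hX : DigConnected adj4 X)
    (hcard : X.ncard ≤ 7) : HasFold adj4 X := by
  by_contra hfold
  have hdeg : ∀ p ∈ X, ∀ q, ∃ r ∈ X, adj4 p r ∧ r ≠ q := by
    intro p hp q
    by_contra! h
    obtain ⟨r, hr, hpr⟩ := hX.exists_adj hnt hp
    obtain rfl := h r hr hpr
    refine hfold (.of_dominated adj4_symm hp hr hpr ?_ fun s hs hps => Or.inl (h s hs hps).symm)
    rintro rfl
    simp [adj4] at hpr
  obtain ⟨c, M, c', m, hc, hc', hrows⟩ := exists_extreme_rows hfin hnt.nonempty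
  obtain ⟨a, b, hab, h1, h2, h3, h4, h5, h6, hrow, e, he, he'⟩ :=
    extreme_row_of_not_hasFold4 hfin hfold hdeg (σ := 1) (Or.inl rfl)
      (fun x hx => by have := (hrows _ _ hx).2; omega) hc
  obtain ⟨a', b', hab', h1', h2', h3', h4', h5', h6', hrow', -⟩ :=
    extreme_row_of_not_hasFold4 hfin hfold hdeg (σ := -1) (Or.inr rfl)
      (fun x hx => by have := (hrows _ _ hx).1; omega) hc'
  have hMm := (hrows _ _ h5).1
  rw [sub_neg_eq_add] at h5' h6'
  rcases (show m + 2 ≤ M ∨ M = m + 1 by omega) with h | rfl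
  · have := length_le_ncard hfin (l := [(a, M), (a + 1, M), (a + 2, M), (a, M - 1), (b, M - 1),
      (a', m), (a' + 1, m), (a' + 2, m)]) (by simp; omega) (by simp [*])
    simp at this
    omega
  · simp only [add_sub_cancel_right] at h5 h6 he'
    have ea := (hrow _ h5').1
    have ea' := (hrow' _ h5).1
    obtain rfl : a = a' := by omega
    have eb := (hrow _ h6').2
    have eb' := (hrow' _ h6).2
    obtain rfl : b = b' := by omega
    have hb : b ≠ a + 2 := by
      rintro rfl
      have := hrow _ he
      obtain rfl | rfl | rfl : e = a ∨ e = a + 1 ∨ e = a + 2 := by omega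
      all_goals exact he' (by assumption)
    have := length_le_ncard hfin (l := [(a, m + 1), (a + 1, m + 1), (a + 2, m + 1), (b, m + 1),
      (a, m), (a + 1, m), (a + 2, m), (b, m)]) (by simp; omega) (by simp [*])
    simp at this
    omega

theorem end_of_extreme_row_of_not_hasFold8 (hfold : ¬ HasFold adj8 X)
    (hdeg : ∀ p ∈ X, ∃ r ∈ X, adj8 p r) {M σ τ a : ℤ} (hσ : σ = 1 ∨ σ = -1)
    (hτ : τ = 1 ∨ τ = -1) (htop : ∀ x, (x, M + σ) ∉ X) (ha : (a, M) ∈ X)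
    (hend : (a + τ, M) ∉ X) : (a, M - σ) ∉ X ∧ (a + τ, M - σ) ∈ X := by
  have hnbr : ∀ x y, (x, y) ∈ X → adj8 (a, M) (x, y) →
      (x = a - τ ∧ y = M) ∨ y = M - σ ∧ (x = a - τ ∨ x = a ∨ x = a + τ) := by
    intro x y h hadj
    have h1 : y ≠ M + σ := by
      rintro rfl
      exact htop x h
    have h2 : ¬(x = a + τ ∧ y = M) := by
      rintro ⟨rfl, rfl⟩
      exact hend h
    rw [adj8_iff] at hadj
    rcases hσ with rfl | rfl <;> rcases hτ with rfl | rfl <;> omega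
  have hbelow : (a, M - σ) ∉ X := by
    intro h
    refine hfold (.of_dominated adj8_symm ha h ?_ ?_ ?_)
    · rw [adj8_iff]; omega
    · simp only [ne_eq, Prod.mk.injEq]; omega
    · rintro ⟨r, s⟩ hr hadj
      have := hnbr r s hr hadj
      rw [Prod.mk.injEq, adj8_iff]
      rcases hσ with rfl | rfl <;> rcases hτ with rfl | rfl <;> omega
  refine ⟨hbelow, ?_⟩
  by_contra hdiag
  have hnbr' : ∀ x y, (x, y) ∈ X → adj8 (a, M) (x, y) → x = a - τ ∧ (y = M ∨ y = M - σ) := by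
    intro x y h hadj
    rcases hnbr x y h hadj with ⟨rfl, rfl⟩ | ⟨rfl, rfl | rfl | rfl⟩
    · exact ⟨rfl, Or.inl rfl⟩
    · exact ⟨rfl, Or.inr rfl⟩
    · exact absurd h hbelow
    · exact absurd h hdiag
  obtain ⟨⟨x, y⟩, hx, hadj⟩ := hdeg _ ha
  refine hfold (.of_dominated adj8_symm ha hx hadj hadj.1 ?_)
  rintro ⟨r, s⟩ hr hadj'
  have h1 := hnbr' r s hr hadj'
  have h2 := hnbr' x y hx hadj
  rw [Prod.mk.injEq, adj8_iff]
  rcases hσ with rfl | rfl <;> omega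

theorem extreme_row_of_not_hasFold8 (hfin : X.Finite) (hfold : ¬ HasFold adj8 X)
    (hdeg : ∀ p ∈ X, ∃ r ∈ X, adj8 p r) {M σ c : ℤ} (hσ : σ = 1 ∨ σ = -1)
    (htop : ∀ x, (x, M + σ) ∉ X) (hc : (c, M) ∈ X) :
    ∃ a b, a ≤ b ∧ (a, M) ∈ X ∧ (b, M) ∈ X ∧ (a - 1, M - σ) ∈ X ∧ (b + 1, M - σ) ∈ X ∧
      (a, M - σ) ∉ X ∧ ∀ x, (x, M) ∈ X → a ≤ x ∧ x ≤ b := by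
  obtain ⟨a, b, ha, hb, hab⟩ := exists_row_bounds hfin hc
  have hl := end_of_extreme_row_of_not_hasFold8 hfold hdeg hσ (τ := -1) (Or.inr rfl) htop ha
    fun h => by have := (hab _ h).1; omega
  have hr := end_of_extreme_row_of_not_hasFold8 hfold hdeg hσ (τ := 1) (Or.inl rfl) htop hb
    fun h => by have := (hab _ h).2; omega
  exact ⟨a, b, (hab b hb).1, ha, hb, hl.2, hr.2, hl.1, hab⟩

/-- An image contained in the diamond of the four `adj4`-neighbours of `(a, n)`, and missing at
most `(a + 1, n)`, has a fold. -/
theorem HasFold.diamond {a n : ℤ} (hl : (a - 1, n) ∈ X)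
    (ht : (a, n + 1) ∈ X) (hb : (a, n - 1) ∈ X)
    (hX : ∀ x y, (x, y) ∈ X → (x = a - 1 ∧ y = n) ∨ (x = a + 1 ∧ y = n) ∨
      (x = a ∧ y = n + 1) ∨ (x = a ∧ y = n - 1)) : HasFold adj8 X := by
  refine ⟨fun p => if p.2 = n + 1 then (a - 1, n) else if p.1 = a + 1 then (a, n - 1) else p,
    ?_, ?_, ?_, (a, n + 1), ht, (a - 1, n), hl, ?_, ?_⟩
  · rintro ⟨x, y⟩ hx
    dsimp only
    split_ifs <;> assumption
  · rintro ⟨x, y⟩ hx ⟨x', y'⟩ hx' hadj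
    have h1 := hX x y hx
    have h2 := hX x' y' hx'
    rw [adj8_iff] at hadj
    dsimp only
    split_ifs <;> rw [Prod.mk.injEq, adj8_iff] <;> omega
  · rintro ⟨x, y⟩ hx
    have h1 := hX x y hx
    dsimp only
    split_ifs <;> rw [Prod.mk.injEq, adj8_iff] <;> omega
  · simp
  · have : ¬(a - 1 = a + 1) := by omega
    simp [this]

theorem hasFold_adj8 (hfin : X.Finite) (hnt : X.Nontrivial) (hX : DigConnected adj8 X)
    (hcard : X.ncard ≤ 5) : HasFold adj8 X := by
  by_contra hfold
  have hdeg : ∀ p ∈ X, ∃ r ∈ X, adj8 p r := fun p hp => hX.exists_adj hnt hp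
  have hleaf : ∀ p ∈ X, ∀ q, ∃ r ∈ X, adj8 p r ∧ r ≠ q := by
    intro p hp q
    by_contra! h
    obtain ⟨r, hr, hpr⟩ := hdeg p hp
    obtain rfl := h r hr hpr
    exact hfold (.of_dominated adj8_symm hp hr hpr hpr.1
      fun s hs hps => Or.inl (h s hs hps).symm)
  have hfive : ∀ l : List (ℤ × ℤ), l.Nodup → l.length = 5 → (∀ x ∈ l, x ∈ X) →
      ∀ z ∈ X, z ∈ l := by
    intro l hl h5 h z hz
    by_contra hzl
    have := length_le_ncard hfin (List.nodup_cons.2 ⟨hzl, hl⟩) (List.forall_mem_cons.2 ⟨hz, h⟩)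
    rw [List.length_cons] at this
    omega
  obtain ⟨c, M, c', m, hc, hc', hrows⟩ := exists_extreme_rows hfin hnt.nonempty
  obtain ⟨a, b, hab, ha, hb, hal, hbr, hcen, hrow⟩ :=
    extreme_row_of_not_hasFold8 hfin hfold hdeg (σ := 1) (Or.inl rfl)
      (fun x hx => by have := (hrows _ _ hx).2; omega) hc
  obtain ⟨a', b', hab', ha', hb', hal', hbr', -, hrow'⟩ :=
    extreme_row_of_not_hasFold8 hfin hfold hdeg (σ := -1) (Or.inr rfl)
      (fun x hx => by have := (hrows _ _ hx).1; omega) hc'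
  rw [sub_neg_eq_add] at hal' hbr'
  have hMm := (hrows _ _ hal).1
  have hM1 : M ≠ m + 1 := by
    rintro rfl
    rw [add_sub_cancel_right] at hal
    have h1 := (hrow' _ hal).1
    have h2 := (hrow _ hal').1
    omega
  obtain rfl : M = m + 2 := by
    by_contra hM
    have := length_le_ncard hfin (l := [(a, M), (a - 1, M - 1), (b + 1, M - 1), (a', m),
      (a' - 1, m + 1), (b' + 1, m + 1)]) (by simp; omega) (by simp [*])
    simp at this
    omega
  have e : m + 2 - 1 = m + 1 := by ring
  rw [e] at hal hbr hcen
  have hab_eq : a = b := by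
    by_contra h
    have hmem := hfive [(a, m + 2), (b, m + 2), (a', m), (a - 1, m + 1), (b + 1, m + 1)]
      (by simp; omega) rfl (by simp [*])
    have h1 := hmem _ hal'
    have h2 := hmem _ hbr'
    have h3 := hmem _ hb'
    simp at h1 h2 h3
    omega
  have hab_eq' : a' = b' := by
    by_contra h
    have hmem := hfive [(a', m), (b', m), (a, m + 2), (a' - 1, m + 1), (b' + 1, m + 1)]
      (by simp; omega) rfl (by simp [*])
    have h1 := hmem _ hal
    have h2 := hmem _ hbr
    simp at h1 h2
    omega
  subst hab_eq hab_eq'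
  rcases lt_trichotomy a a' with h | rfl | h
  · have hmem := hfive [(a, m + 2), (a', m), (a - 1, m + 1), (a + 1, m + 1), (a' + 1, m + 1)]
      (by simp; omega) rfl (by simp [*])
    have h1 := hmem _ hal'
    obtain ⟨⟨r, s⟩, hr, hadj, hne⟩ := hleaf _ hal (a, m + 2)
    have h2 := hmem _ hr
    rw [adj8_iff] at hadj
    simp at h1 h2 hne
    omega
  · refine hfold (.diamond (n := m + 1) hal (by rwa [add_assoc]) (by simpa using ha') ?_)
    intro x y hxy
    by_contra hz
    have hmem := hfive [(a, m + 2), (a, m), (a - 1, m + 1), (a + 1, m + 1), (x, y)]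
      (by simp; omega) rfl (by simp [*])
    have hy := hrows x y hxy
    obtain rfl : y = m + 1 := by
      rcases (show y = m ∨ y = m + 1 ∨ y = m + 2 by omega) with rfl | rfl | rfl
      · have := hrow' x hxy
        omega
      · rfl
      · have := hrow x hxy
        omega
    have hx : x ≠ a := by
      rintro rfl
      exact hcen hxy
    obtain ⟨⟨r, s⟩, hr, hadj, hne⟩ := hleaf _ hxy (if x < a then a - 1 else a + 1, m + 1)
    have h2 := hmem _ hr
    rw [adj8_iff] at hadj
    split_ifs at hne <;> simp at h2 hne <;> omega
  · have hmem := hfive [(a, m + 2), (a', m), (a - 1, m + 1), (a + 1, m + 1), (a' - 1, m + 1)]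
      (by simp; omega) rfl (by simp [*])
    have h1 := hmem _ hbr'
    obtain ⟨⟨r, s⟩, hr, hadj, hne⟩ := hleaf _ hbr (a, m + 2)
    have h2 := hmem _ hr
    rw [adj8_iff] at hadj
    simp at h1 h2 hne
    omega

end Plane

/-- a digitally connected digital image `X ⊆ ℤ²` with `m` points has
`TC(X,8) = 1` for `m < 6` and `TC(X,4) = 1` for `m < 8`. -/
theorem stmt_8 (X : Set (ℤ × ℤ)) (hfin : X.Finite) (hne : X.Nonempty)
    (m : ℕ) (hm : X.ncard = m) :
    (DigConnected adj8 X → m < 6 → digTC adj8 X = 1) ∧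
    (DigConnected adj4 X → m < 8 → digTC adj4 X = 1) := by
  subst hm
  refine ⟨fun hX h => digTC_eq_one_of_contractible hne ?_,
    fun hX h => digTC_eq_one_of_contractible hne ?_⟩
  · exact .of_forall_hasFold adj8_symm 5 (fun Y h1 h2 h3 h4 => hasFold_adj8 h1 h2 h3 h4)
      hfin hne hX (by omega)
  · exact .of_forall_hasFold adj4_symm 7 (fun Y h1 h2 h3 h4 => hasFold_adj4 h1 h2 h3 h4)
      hfin hne hX (by omega)
end

section
/- Let X ⊆ ℤ be a finite 2-connected digital image and let n ≥ 1 be an integer. Then TC_n(X,2) = 1. -/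
/-- A digitally connected subset of `ℤ` contains every integer between two of its points. -/
theorem DigConnected.mem_of_le_of_le {X : Set ℤ} (hconn : DigConnected adjZ X) {a b z : ℤ}
    (ha : a ∈ X) (hb : b ∈ X) (haz : a ≤ z) (hzb : z ≤ b) : z ∈ X := by
  have key : ∀ y, Relation.ReflTransGen (fun a b => a ∈ X ∧ b ∈ X ∧ adjZ a b) a y →
      ∀ z, a ≤ z → z ≤ y → z ∈ X := by
    intro y hy
    induction hy with
    | refl =>
      intro z h₁ h₂
      exact le_antisymm h₁ h₂ ▸ ha
    | @tail y y' _ hstep ih =>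
      intro z h₁ h₂
      obtain ⟨-, hy', hadj⟩ := hstep
      rcases h₂.eq_or_lt with rfl | hlt
      · exact hy'
      · refine ih z h₁ ?_
        have := (abs_le.mp (le_of_eq hadj)).1
        omega
  exact key b (hconn a ha b hb) z haz hzb

/-- A digital image that is the image of a single digital path has `TCₙ ≤ 1`: pair every tuple
of points with that path. -/
theorem TCnle_one_of_surjective_path {α : Type} {A : α → α → Prop} {X : Set α} {p : DigPath α}
    (hp : IsDigPath A X p)
    (hsurj : ∀ x ∈ X, ∃ t ∈ Set.Icc (0 : ℤ) (p.len : ℤ), p.toFun t = x) (n : ℕ) :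
    TCnle A X n 1 := by
  refine ⟨fun _ => {u | ∀ i, u i ∈ X}, Set.iUnion_const _, fun _ => ⟨fun u => ⟨p, u⟩,
    fun u hu => ⟨hp, fun i => hsurj (u i) (hu i)⟩, ?_, fun _ _ => rfl⟩⟩
  intro u _ v _ huv
  exact Or.inr ⟨fun h => huv.1 (congrArg SnElt.pts h), fun _ _ => Or.inl rfl, huv.2⟩

/-- The higher topological complexity of a nonempty digital image is at least `1`. -/
theorem one_le_digTCn {α : Type} (A : α → α → Prop) {X : Set α} (hne : X.Nonempty) (n : ℕ) :
    1 ≤ digTCn A X n := by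
  refine le_sInf ?_
  rintro _ ⟨k, rfl, U, hU, -⟩
  obtain ⟨x, hx⟩ := hne
  have hmem : (fun _ : Fin n => x) ∈ ⋃ j, U j := by
    rw [hU]
    exact fun _ => hx
  obtain ⟨j, -⟩ := Set.mem_iUnion.mp hmem
  exact_mod_cast Nat.succ_le_of_lt j.pos

/-- a finite digitally connected digital image `X ⊆ ℤ` has
`TCₙ(X,2) = 1` for every `n ≥ 1`. -/
theorem stmt_14 (X : Set ℤ) (hfin : X.Finite) (hne : X.Nonempty)
    (hconn : DigConnected adjZ X) (n : ℕ) (hn : 1 ≤ n) :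
    digTCn adjZ X n = 1 := by
  obtain ⟨a, ha, hmin⟩ := Set.exists_min_image X id hfin hne
  obtain ⟨b, hb, hmax⟩ := Set.exists_max_image X id hfin hne
  simp only [id] at hmin hmax
  have hab : a ≤ b := hmin b hb
  have hlen : ((b - a).toNat : ℤ) = b - a := Int.toNat_of_nonneg (by omega)
  refine le_antisymm (sInf_le ⟨1, rfl, ?_⟩) (one_le_digTCn adjZ hne n)
  refine TCnle_one_of_surjective_path (p := ⟨(b - a).toNat, fun t => a + t⟩) ⟨?_, ?_⟩ ?_ n
  · rintro t ⟨h₀, h₁⟩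
    exact hconn.mem_of_le_of_le ha hb (by dsimp only at *; omega) (by dsimp only at *; omega)
  · intro t _ t' _ h
    right
    simpa [adjZ] using h
  · intro x hx
    have h₁ := hmin x hx
    have h₂ := hmax x hx
    exact ⟨x - a, ⟨by omega, by dsimp only; omega⟩, by dsimp only; omega⟩
end
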